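/- Let K be a field containing F_q and A ∈ GL_n(K). Then the K-algebra F = K[X_1,...,X_n]/⟨A X^{(q)} − X⟩, where the ideal is generated by the n coordinates of A X^{(q)} − X, is étale over K; in fact F ⊗_K \bar{K} is isomorphic as a \bar{K}-algebra to a product of q^n copies of \bar{K}. -/

import Mathlib

open Polynomial in
theorem aux_root {L : Type*} [Field L] [IsAlgClosed L] (q : ℕ) (hq : 2 ≤ q) (a : ℕ → L) (m : ℕ)
    (ha : ∃ i ≤ m, a i ≠ 0) :
    ∃ x : ℕ → L, x m ≠ 0 ∧ x 0 = a 0 * x m ^ q ∧ ∀ i, x (i + 1) = x i ^ q + a (i + 1) * x m ^ q := by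
  let p : ℕ → L[X] := fun i => Nat.rec (C (a 0) * X ^ q) (fun i r => r ^ q + C (a (i + 1)) * X ^ q) i
  have p0 : p 0 = C (a 0) * X ^ q := rfl
  have ps : ∀ i, p (i + 1) = p i ^ q + C (a (i + 1)) * X ^ q := fun i => rfl
  have hX : ∀ c : L, X ^ 2 ∣ C c * (X : L[X]) ^ q := fun c => (pow_dvd_pow X hq).mul_left _
  have hdvd : ∀ i, X ^ 2 ∣ p i := by
    intro i
    induction i with
    | zero => rw [p0]; exact hX _
    | succ i ih =>
      rw [ps]
      exact dvd_add (ih.trans (dvd_pow_self _ (by omega))) (hX _)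
  have hz : ∀ i, p i = 0 → ∀ j ≤ i, a j = 0 := by
    intro i
    induction i with
    | zero =>
      intro h j hj
      obtain rfl : j = 0 := by omega
      rw [p0] at h
      simpa using h
    | succ i ih =>
      intro h j hj
      rw [ps] at h
      have h1 : (X : L[X]) ^ (q + 1) ∣ C (a (i + 1)) * X ^ q := by
        have : C (a (i + 1)) * X ^ q = - (p i ^ q) := by linear_combination h
        rw [this, dvd_neg]
        refine (pow_dvd_pow X (by omega : q + 1 ≤ 2 * q)).trans ?_
        rw [pow_mul]
        exact pow_dvd_pow_of_dvd (hdvd i) q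
      have h2 : a (i + 1) = 0 := by
        have := (X_pow_dvd_iff.mp h1) q (by omega)
        simpa using this
      rw [h2] at h
      have h3 : p i = 0 := by
        have : p i ^ q = 0 := by simpa using h
        exact pow_eq_zero_iff (by omega) |>.mp this
      rcases Nat.lt_or_ge i j with h4 | h4
      · obtain rfl : j = i + 1 := by omega
        exact h2
      · exact ih h3 j h4
  obtain ⟨s, hs⟩ := hdvd m
  have hs0 : s ≠ 0 := by
    rintro rfl
    obtain ⟨i, hi, hi'⟩ := ha
    exact hi' (hz m (by simpa using hs) i hi)
  have hdeg : (X * s - 1).degree ≠ 0 := by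
    have h1 : (X * s).degree = s.degree + 1 := by rw [mul_comm, degree_mul_X]
    have h2 : s.degree = s.natDegree := degree_eq_natDegree hs0
    have h3 : (1 : WithBot ℕ) ≤ (X * s).degree := by
      rw [h1, h2]; exact_mod_cast Nat.le_add_left 1 _
    have h0 : (0 : WithBot ℕ) < (X * s).degree := lt_of_lt_of_le (by exact_mod_cast Nat.one_pos) h3
    rw [degree_sub_eq_left_of_degree_lt (by rw [degree_one]; exact h0)]
    exact h0.ne'
  obtain ⟨t, ht⟩ := IsAlgClosed.exists_root _ hdeg
  have ht' : t * s.eval t = 1 := by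
    have : t * s.eval t - 1 = 0 := by simpa [IsRoot] using ht
    linear_combination this
  have htm : (p m).eval t = t := by
    rw [hs]; simp only [eval_mul, eval_pow, eval_X]
    linear_combination t * ht'
  refine ⟨fun i => (p i).eval t, ?_, ?_, ?_⟩
  · show (p m).eval t ≠ 0
    rw [htm]; rintro rfl; simp at ht'
  · show (p 0).eval t = a 0 * ((p m).eval t) ^ q
    rw [htm, p0]; simp
  · intro i
    show (p (i + 1)).eval t = ((p i).eval t) ^ q + a (i + 1) * ((p m).eval t) ^ q
    rw [htm, ps]; simp

theorem aux_fixed {L V : Type*} [Field L] [IsAlgClosed L] [AddCommGroup V] [Module L V]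
    [Module.Finite L V] [Nontrivial V] (q : ℕ) (hq : 2 ≤ q) (σ : L →+* L) (hσ : ∀ x, σ x = x ^ q)
    (φ : V →ₛₗ[σ] V) (hφ : Function.Injective φ) : ∃ x, x ≠ 0 ∧ φ x = x := by
  classical
  obtain ⟨v, hv⟩ := exists_ne (0 : V)
  let w : ℕ → V := fun i => φ^[i] v
  have ws : ∀ i, φ (w i) = w (i + 1) := fun i => (Function.iterate_succ_apply' φ i v).symm
  have w0 : ∀ i, w i ≠ 0 := by
    intro i
    induction i with
    | zero => exact hv
    | succ i ih => rw [← ws]; intro h; exact ih (hφ (by rw [h, map_zero]))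
  have hex : ∃ m, ¬ LinearIndependent L (fun i : Fin m => w i) := by
    refine ⟨Module.finrank L V + 1, fun h => ?_⟩
    have := h.fintype_card_le_finrank
    simp at this
  obtain ⟨k, hk⟩ : ∃ k, Nat.find hex = k + 1 := by
    apply Nat.exists_eq_succ_of_ne_zero
    intro h
    have := Nat.find_spec hex
    rw [h] at this
    exact this linearIndependent_empty_type
  have hli : LinearIndependent L (fun i : Fin k => w i) :=
    not_not.mp (Nat.find_min hex (by omega : k < Nat.find hex))
  have hnli : ¬ LinearIndependent L (fun i : Fin (k + 1) => w i) := by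
    have := Nat.find_spec hex
    rwa [hk] at this
  have hsn : (fun i : Fin (k + 1) => w i) = Fin.snoc (fun i : Fin k => w i) (w k) := by
    funext i
    refine Fin.lastCases ?_ (fun j => ?_) i <;> simp
  rw [hsn, linearIndependent_finSnoc] at hnli
  have hmem : w k ∈ Submodule.span L (Set.range fun i : Fin k => w i) := by
    by_contra h; exact hnli ⟨hli, h⟩
  obtain ⟨c, hc⟩ := (Submodule.mem_span_range_iff_exists_fun L).mp hmem
  let a : ℕ → L := fun i => if h : i < k then c ⟨i, h⟩ else 0
  have hc' : ∑ i ∈ Finset.range k, a i • w i = w k := by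
    rw [← hc, ← Fin.sum_univ_eq_sum_range (fun i => a i • w i)]
    refine Finset.sum_congr rfl fun i _ => ?_
    simp [a]
  obtain ⟨m, rfl⟩ : ∃ m, k = m + 1 := by
    apply Nat.exists_eq_succ_of_ne_zero
    rintro rfl
    exact w0 0 (by simpa using hc'.symm)
  have ha : ∃ i ≤ m, a i ≠ 0 := by
    by_contra! h
    refine w0 (m + 1) ?_
    rw [← hc']
    refine Finset.sum_eq_zero fun i hi => ?_
    rw [h i (by have := Finset.mem_range.mp hi; omega), zero_smul]
  obtain ⟨x, hx, hx0, hxs⟩ := aux_root q hq a m ha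
  refine ⟨∑ i ∈ Finset.range (m + 1), x i • w i, ?_, ?_⟩
  · intro h
    rw [← Fin.sum_univ_eq_sum_range (fun i => x i • w i)] at h
    have := Fintype.linearIndependent_iff.mp hli (fun i => x i) h (Fin.last m)
    exact hx (by simpa using this)
  · rw [map_sum]
    simp only [map_smulₛₗ, hσ, ws]
    rw [Finset.sum_range_succ, ← hc', Finset.sum_range_succ' (fun i => a i • w i),
      Finset.sum_range_succ' (fun i => x i • w i), hx0]
    simp only [hxs, add_smul, Finset.sum_add_distrib, smul_add, Finset.smul_sum, smul_smul]
    simp only [mul_comm (x m ^ q)]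
    abel

open Polynomial in
theorem aux_AS {L : Type*} [Field L] [IsAlgClosed L] (q : ℕ) (hq : 2 ≤ q) (r : L) :
    ∃ t : L, t - t ^ q = r := by
  have hd : (X ^ q - X + C r : L[X]).degree ≠ 0 := by
    have : (X ^ q - X + C r : L[X]) = X ^ q - (X - C r) := by ring
    rw [this, degree_sub_eq_left_of_degree_lt, degree_X_pow]
    · simp; omega
    · rw [degree_X_sub_C, degree_X_pow]
      exact_mod_cast hq
  obtain ⟨t, ht⟩ := IsAlgClosed.exists_root _ hd
  refine ⟨t, ?_⟩
  have : t ^ q - t + r = 0 := by simpa [IsRoot] using ht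
  linear_combination -this

theorem aux_span {L V : Type*} [Field L] [IsAlgClosed L] [AddCommGroup V] [Module L V]
    [Module.Finite L V] (q : ℕ) (hq : 2 ≤ q) (σ : L →+* L) (hσ : ∀ x, σ x = x ^ q)
    (φ : V →ₛₗ[σ] V) (hφ : Function.Injective φ) : ⊤ ≤ Submodule.span L {x | φ x = x} := by
  set W := Submodule.span L {x | φ x = x} with hW
  by_contra hne
  have hWφ : W ≤ W.comap φ := by
    rw [hW, Submodule.span_le]
    intro x hx
    have hx' : φ x = x := hx
    show φ x ∈ Submodule.span L {x | φ x = x}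
    rw [hx']
    exact Submodule.subset_span hx
  have hsurj : ∀ w ∈ W, ∃ y ∈ W, φ y = w := by
    intro w hw
    induction hw using Submodule.closure_induction with
    | zero => exact ⟨0, W.zero_mem, map_zero φ⟩
    | add x y _ _ hx hy =>
      obtain ⟨x', h1, rfl⟩ := hx
      obtain ⟨y', h2, rfl⟩ := hy
      exact ⟨x' + y', W.add_mem h1 h2, map_add φ _ _⟩
    | smul_mem r x hx =>
      obtain ⟨s, hs⟩ := IsAlgClosed.exists_pow_nat_eq r (by omega : 0 < q)
      refine ⟨s • x, W.smul_mem _ (Submodule.subset_span hx), ?_⟩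
      rw [map_smulₛₗ, hσ, hs, show φ x = x from hx]
  have hAS : ∀ w ∈ W, ∃ y ∈ W, y - φ y = w := by
    intro w hw
    induction hw using Submodule.closure_induction with
    | zero => exact ⟨0, W.zero_mem, by simp⟩
    | add x y _ _ hx hy =>
      obtain ⟨x', h1, rfl⟩ := hx
      obtain ⟨y', h2, rfl⟩ := hy
      exact ⟨x' + y', W.add_mem h1 h2, by rw [map_add]; abel⟩
    | smul_mem r x hx =>
      obtain ⟨s, hs⟩ := aux_AS q hq r
      refine ⟨s • x, W.smul_mem _ (Submodule.subset_span hx), ?_⟩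
      rw [map_smulₛₗ, hσ, ← hs, show φ x = x from hx, sub_smul]
  have : Nontrivial (V ⧸ W) := Submodule.Quotient.nontrivial_iff.mpr (fun h => hne h.ge)
  have hinj : Function.Injective (W.mapQ W φ hWφ) := by
    rw [injective_iff_map_eq_zero]
    intro x hx
    obtain ⟨v, rfl⟩ := Submodule.Quotient.mk_surjective W x
    rw [Submodule.mapQ_apply, Submodule.Quotient.mk_eq_zero] at hx
    obtain ⟨y, hy, hy'⟩ := hsurj _ hx
    rw [Submodule.Quotient.mk_eq_zero, ← hφ hy']
    exact hy
  obtain ⟨x, hx0, hx⟩ := aux_fixed q hq σ hσ (W.mapQ W φ hWφ) hinj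
  obtain ⟨v, rfl⟩ := Submodule.Quotient.mk_surjective W x
  rw [Submodule.mapQ_apply, Submodule.Quotient.eq] at hx
  obtain ⟨y, hy, hy'⟩ := hAS _ hx
  apply hx0
  rw [Submodule.Quotient.mk_eq_zero]
  have hfix : φ (v + y) = v + y := by
    rw [map_add]
    have : φ v = y - φ y + v := by rw [hy']; abel
    rw [this]; abel
  have h1 : v + y ∈ W := Submodule.subset_span hfix
  simpa using W.sub_mem h1 hy

open Polynomial in
theorem aux_range {F L : Type*} [Field F] [Fintype F] [Field L] [Algebra F L] (x : L)
    (hx : x ^ Fintype.card F = x) : ∃ a : F, algebraMap F L a = x := by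
  have h1 : (X ^ Fintype.card F - X : F[X]).Monic :=
    monic_X_pow_sub (by rw [degree_X]; exact_mod_cast Fintype.one_lt_card)
  have h2 := prod_multiset_X_sub_C_of_monic_of_roots_card_eq h1 (by
    rw [FiniteField.roots_X_pow_card_sub_X, FiniteField.X_pow_card_sub_X_natDegree_eq _ Fintype.one_lt_card]
    rfl)
  have h3 := congrArg (aeval x) h2
  rw [FiniteField.roots_X_pow_card_sub_X] at h3
  simp only [map_sub, map_pow, aeval_X, hx, sub_self] at h3
  change aeval x (∏ a : F, (X - C a)) = 0 at h3
  rw [map_prod, Finset.prod_eq_zero_iff] at h3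
  obtain ⟨a, -, ha⟩ := h3
  refine ⟨a, ?_⟩
  simp only [map_sub, aeval_X, aeval_C] at ha
  exact (sub_eq_zero.mp ha).symm

theorem aux_count {F L : Type*} [Field F] [Fintype F] [Field L] [IsAlgClosed L] [Algebra F L]
    (n : ℕ) (A : Matrix (Fin n) (Fin n) L) (hA : IsUnit A) :
    Nonempty ((Fin n → F) ≃ {x : Fin n → L // ∀ i, ∑ j, A i j * x j ^ Fintype.card F = x i}) := by
  classical
  set σ : L →+* L := (FiniteField.frobeniusAlgHom F L : L →+* L) with hσdef
  have hσ : ∀ x, σ x = x ^ Fintype.card F := fun x => rfl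
  let φ : (Fin n → L) →ₛₗ[σ] (Fin n → L) :=
    { toFun := fun x => A.mulVec (fun j => σ (x j))
      map_add' := by
        intro x y
        rw [← Matrix.mulVec_add]; congr 1; funext j; simp
      map_smul' := by
        intro c x
        rw [← Matrix.mulVec_smul]; congr 1; funext j; simp }
  have hφa : ∀ x i, φ x i = ∑ j, A i j * x j ^ Fintype.card F := fun x i => rfl
  have hφ : Function.Injective φ := by
    intro x y h
    have h1 := Matrix.mulVec_injective_of_isUnit hA h
    funext j
    exact σ.injective (congrFun h1 j)
  have hspan := aux_span (Fintype.card F) Fintype.one_lt_card σ hσ φ hφ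
  let b₀ := Module.Basis.ofSpan hspan
  have : Fintype _ := Module.Basis.fintypeIndexOfRankLtAleph0 b₀ (Module.rank_lt_aleph0 L _)
  have hcard : Fintype.card _ = n := (Module.finrank_eq_card_basis b₀).symm.trans (by simp)
  let b := b₀.reindex (Fintype.equivFinOfCardEq hcard)
  have hb : ∀ i, φ (b i) = b i := by
    intro i
    have : b i ∈ Set.range b₀ := by rw [Module.Basis.reindex_apply]; exact ⟨_, rfl⟩
    exact Module.Basis.ofSpan_subset hspan this
  have hsum : ∀ r : Fin n → L, φ (∑ i, r i • b i) = ∑ i, r i ^ Fintype.card F • b i := by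
    intro r
    rw [map_sum]
    simp only [map_smulₛₗ, hb, hσ]
  refine ⟨Equiv.ofBijective (fun c => ⟨∑ i, algebraMap F L (c i) • b i, ?_⟩) ⟨?_, ?_⟩⟩
  · intro i
    rw [← hφa, hsum]
    simp only [← map_pow, FiniteField.pow_card]
  · intro c d h
    have h1 : ∑ i, algebraMap F L (c i) • b i = ∑ i, algebraMap F L (d i) • b i :=
      congrArg Subtype.val h
    funext i
    have h2 := congrArg (fun v => b.repr v i) h1
    simp only [Module.Basis.repr_sum_self] at h2
    exact (algebraMap F L).injective h2
  · rintro ⟨x, hx⟩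
    have hx' : φ x = x := funext fun i => hx i
    have hr : ∀ i, b.repr x i ^ Fintype.card F = b.repr x i := by
      intro i
      have h1 := hsum (fun i => b.repr x i)
      rw [b.sum_repr x, hx'] at h1
      have h2 := congrArg (fun v => b.repr v i) h1
      simp only [Module.Basis.repr_sum_self] at h2
      exact h2.symm
    choose c hc using fun i => aux_range (F := F) _ (hr i)
    refine ⟨c, Subtype.ext ?_⟩
    simp only [hc]
    exact b.sum_repr x

theorem aux_unram {K : Type*} [Field K] (q : ℕ) (hq : (q : K) = 0) (n : ℕ)
    (A : Matrix (Fin n) (Fin n) K) (I : Ideal (MvPolynomial (Fin n) K))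
    (hI : I = Ideal.span (Set.range fun i : Fin n =>
      (∑ j, MvPolynomial.C (A i j) * MvPolynomial.X j ^ q) - MvPolynomial.X i)) :
    Algebra.FormallyUnramified K (MvPolynomial (Fin n) K ⧸ I) := by
  have hrel : ∀ i, Ideal.Quotient.mkₐ K I (MvPolynomial.X i) =
      ∑ j, A i j • (Ideal.Quotient.mkₐ K I (MvPolynomial.X j)) ^ q := by
    intro i
    have h1 : (∑ j, MvPolynomial.C (A i j) * MvPolynomial.X j ^ q) - MvPolynomial.X i ∈ I := by
      rw [hI]; exact Ideal.subset_span ⟨i, rfl⟩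
    have h2 : Ideal.Quotient.mkₐ K I
      ((∑ j, MvPolynomial.C (A i j) * MvPolynomial.X j ^ q) - MvPolynomial.X i) = 0 :=
      Ideal.Quotient.eq_zero_iff_mem.mpr h1
    rw [map_sub, sub_eq_zero, map_sum] at h2
    rw [← h2]
    refine Finset.sum_congr rfl fun j _ => ?_
    rw [← MvPolynomial.smul_eq_C_mul, map_smul, map_pow]
  have hX : ∀ i, KaehlerDifferential.D K (MvPolynomial (Fin n) K ⧸ I)
      (Ideal.Quotient.mkₐ K I (MvPolynomial.X i)) = 0 := by
    intro i
    rw [hrel, map_sum]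
    refine Finset.sum_eq_zero fun j _ => ?_
    rw [Derivation.map_smul, Derivation.leibniz_pow, ← Nat.cast_smul_eq_nsmul K, hq, zero_smul, smul_zero]
  constructor
  have hall : ∀ p : MvPolynomial (Fin n) K, KaehlerDifferential.D K (MvPolynomial (Fin n) K ⧸ I)
      (Ideal.Quotient.mkₐ K I p) = 0 := by
    intro p
    induction p using MvPolynomial.induction_on with
    | C a =>
      have : Ideal.Quotient.mkₐ K I (MvPolynomial.C a) = algebraMap K _ a := rfl
      rw [this, Derivation.map_algebraMap]
    | add p r hp hr => rw [map_add, map_add, hp, hr, add_zero]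
    | mul_X p i hp => rw [map_mul, Derivation.leibniz, hp, hX]; simp
  have htop := KaehlerDifferential.span_range_derivation K (MvPolynomial (Fin n) K ⧸ I)
  have hbot : Submodule.span (MvPolynomial (Fin n) K ⧸ I)
      (Set.range (KaehlerDifferential.D K (MvPolynomial (Fin n) K ⧸ I))) = ⊥ := by
    rw [Submodule.span_eq_bot]
    rintro _ ⟨y, rfl⟩
    obtain ⟨p, rfl⟩ := Ideal.Quotient.mkₐ_surjective K I y
    exact hall p
  rw [← Submodule.subsingleton_iff (MvPolynomial (Fin n) K ⧸ I), ← subsingleton_iff_bot_eq_top]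
  exact hbot.symm.trans htop

theorem aux_points {K L : Type*} [Field K] [Field L] [Algebra K L] (q : ℕ) (n : ℕ)
    (A : Matrix (Fin n) (Fin n) K) (I : Ideal (MvPolynomial (Fin n) K))
    (hI : I = Ideal.span (Set.range fun i : Fin n =>
      (∑ j, MvPolynomial.C (A i j) * MvPolynomial.X j ^ q) - MvPolynomial.X i)) :
    Nonempty (((MvPolynomial (Fin n) K ⧸ I) →ₐ[K] L) ≃
      {x : Fin n → L // ∀ i, ∑ j, A.map (algebraMap K L) i j * x j ^ q = x i}) := by
  have hgen : ∀ (g : MvPolynomial (Fin n) K →ₐ[K] L) (i : Fin n),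
      g ((∑ j, MvPolynomial.C (A i j) * MvPolynomial.X j ^ q) - MvPolynomial.X i) =
        ∑ j, A.map (algebraMap K L) i j * g (MvPolynomial.X j) ^ q - g (MvPolynomial.X i) := by
    intro g i
    rw [map_sub, map_sum]
    congr 1
    refine Finset.sum_congr rfl fun j _ => ?_
    rw [map_mul, map_pow, ← MvPolynomial.algebraMap_eq, AlgHom.commutes, Matrix.map_apply]
  refine ⟨Equiv.ofBijective
    (fun f => ⟨fun i => f (Ideal.Quotient.mkₐ K I (MvPolynomial.X i)), ?_⟩) ⟨?_, ?_⟩⟩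
  · intro i
    have h := hgen (f.comp (Ideal.Quotient.mkₐ K I)) i
    have h1 : (∑ j, MvPolynomial.C (A i j) * MvPolynomial.X j ^ q) - MvPolynomial.X i ∈ I := by
      rw [hI]; exact Ideal.subset_span ⟨i, rfl⟩
    have h2 : Ideal.Quotient.mkₐ K I
      ((∑ j, MvPolynomial.C (A i j) * MvPolynomial.X j ^ q) - MvPolynomial.X i) = 0 :=
      Ideal.Quotient.eq_zero_iff_mem.mpr h1
    rw [AlgHom.comp_apply, h2, map_zero] at h
    exact sub_eq_zero.mp h.symm
  · intro f g h
    have h1 := congrArg Subtype.val h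
    apply Ideal.Quotient.algHom_ext
    apply MvPolynomial.algHom_ext
    intro i
    exact congrFun h1 i
  · rintro ⟨x, hx⟩
    have hle : ∀ a ∈ I, MvPolynomial.aeval (R := K) x a = 0 := by
      have : I ≤ RingHom.ker (MvPolynomial.aeval (R := K) x) := by
        rw [hI, Ideal.span_le]
        rintro _ ⟨i, rfl⟩
        rw [SetLike.mem_coe, RingHom.mem_ker, hgen]
        simp only [MvPolynomial.aeval_X]
        rw [hx i, sub_self]
      exact this
    refine ⟨Ideal.Quotient.liftₐ I (MvPolynomial.aeval x) hle, Subtype.ext (funext fun i => ?_)⟩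
    show MvPolynomial.aeval (R := K) x (MvPolynomial.X i) = x i
    simp


open TensorProduct in
/-- Let `K ⊇ F_q` and `A ∈ GL_n(K)`. The `K`-algebra
`𝓕 = K[X_1,...,X_n] / ⟨A X^{(q)} − X⟩` is étale over `K`; in fact `𝓕 ⊗_K K̄` is
isomorphic as a `K̄`-algebra to a product of `q^n` copies of `K̄` (indexed by `F_q^n`). -/
theorem stmt_6 (F : Type*) [Field F] [Fintype F] (q : ℕ) (hq : q = Fintype.card F)
    (K : Type*) [Field K] [Algebra F K]
    (n : ℕ) (A : Matrix (Fin n) (Fin n) K) (hA : IsUnit A)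
    (I : Ideal (MvPolynomial (Fin n) K))
    (hI : I = Ideal.span (Set.range fun i : Fin n =>
      (∑ j, MvPolynomial.C (A i j) * MvPolynomial.X j ^ q) - MvPolynomial.X i)) :
    Algebra.Etale K (MvPolynomial (Fin n) K ⧸ I) ∧
      Nonempty ((AlgebraicClosure K ⊗[K] (MvPolynomial (Fin n) K ⧸ I))
        ≃ₐ[AlgebraicClosure K] ((Fin n → F) → AlgebraicClosure K)) := by
  subst hq
  have hq0 : ((Fintype.card F : ℕ) : K) = 0 := by
    rw [← map_natCast (algebraMap F K), FiniteField.cast_card_eq_zero, map_zero]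
  have hun := aux_unram (Fintype.card F) hq0 n A I hI
  have : Algebra.FiniteType K (MvPolynomial (Fin n) K ⧸ I) := inferInstance
  have het : Algebra.FormallyEtale K (MvPolynomial (Fin n) K ⧸ I) :=
    .of_formallyUnramified_of_field K _
  have hfp : Algebra.FinitePresentation K (MvPolynomial (Fin n) K ⧸ I) :=
    Algebra.FinitePresentation.of_finiteType.mp this
  refine ⟨⟨het, hfp⟩, ?_⟩
  obtain ⟨e1⟩ := aux_points (L := AlgebraicClosure K) (Fintype.card F) n A I hI
  let _ : Algebra F (AlgebraicClosure K) := ((algebraMap K (AlgebraicClosure K)).comp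
    (algebraMap F K)).toAlgebra
  obtain ⟨e2⟩ := aux_count (F := F) n (A.map (algebraMap K (AlgebraicClosure K)))
    (hA.map (algebraMap K (AlgebraicClosure K)).mapMatrix)
  let e3 := Algebra.TensorProduct.liftEquivRight K (AlgebraicClosure K)
    (MvPolynomial (Fin n) K ⧸ I) (AlgebraicClosure K)
  let e4 := Algebra.IsFiniteSplit.algHomEquivPrimeSpectrum (AlgebraicClosure K)
    (AlgebraicClosure K ⊗[K] (MvPolynomial (Fin n) K ⧸ I))
  let e : (Fin n → F) ≃ PrimeSpectrum (AlgebraicClosure K ⊗[K] (MvPolynomial (Fin n) K ⧸ I)) :=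
    e2.trans (e1.symm.trans (e3.trans e4))
  exact ⟨(Algebra.FormallyEtale.equivPiOfIsSepClosed (AlgebraicClosure K)
    (AlgebraicClosure K ⊗[K] (MvPolynomial (Fin n) K ⧸ I))).trans
    (AlgEquiv.piCongrLeft (AlgebraicClosure K) (fun _ => AlgebraicClosure K) e).symm⟩
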